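/- arXiv:2409.06915 — 3 statements merged into one kernel-verified Lean document; each statement's English description precedes it below -/
import Mathlib

section
/- If u is a ground state, then u is strictly decreasing: u'(r) < 0 for all r ∈ (0,∞). -/
open Real Filter Set

/-- The nonlinearity `f(s) = -s + |s|^(p-1) s`. -/
noncomputable def f (p s : ℝ) : ℝ := -s + |s| ^ (p - 1) * s

/-- The derivative of the nonlinearity, `f'(s) = -1 + p |s|^(p-1)`. -/
noncomputable def fder (p s : ℝ) : ℝ := -1 + p * |s| ^ (p - 1)

/-- The primitive `F(s) = -s^2/2 + |s|^(p+1)/(p+1)`. -/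
noncomputable def F (p s : ℝ) : ℝ := -s ^ 2 / 2 + |s| ^ (p + 1) / (p + 1)

/-- `u : [0,∞) → ℝ` (modeled on `Set.Ici 0`) is a C² solution of the IVP
`u'' + ((n-1)/r) u' + f(u) = 0`, `u(0) = α`, `u'(0) = 0`; the data `u'`, `u''`
are its first and second derivatives on `[0,∞)`. -/
structure IsSolution (n : ℕ) (p α : ℝ) (u u' u'' : ℝ → ℝ) : Prop where
  init : u 0 = α
  initDeriv : u' 0 = 0
  hasDeriv1 : ∀ r ∈ Set.Ici (0:ℝ), HasDerivWithinAt u (u' r) (Set.Ici 0) r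
  hasDeriv2 : ∀ r ∈ Set.Ici (0:ℝ), HasDerivWithinAt u' (u'' r) (Set.Ici 0) r
  cont2 : ContinuousOn u'' (Set.Ici 0)
  ode : ∀ r : ℝ, 0 < r → u'' r + ((n : ℝ) - 1) / r * u' r + f p (u r) = 0

/-- The variation `v` associated with a solution `u`: the C² solution of the linearized
equation `v'' + ((n-1)/r) v' + f'(u) v = 0`, `v(0) = 1`, `v'(0) = 0`. -/
structure IsVariation (n : ℕ) (p : ℝ) (u v v' v'' : ℝ → ℝ) : Prop where
  init : v 0 = 1
  initDeriv : v' 0 = 0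
  hasDeriv1 : ∀ r ∈ Set.Ici (0:ℝ), HasDerivWithinAt v (v' r) (Set.Ici 0) r
  hasDeriv2 : ∀ r ∈ Set.Ici (0:ℝ), HasDerivWithinAt v' (v'' r) (Set.Ici 0) r
  cont2 : ContinuousOn v'' (Set.Ici 0)
  ode : ∀ r : ℝ, 0 < r → v'' r + ((n : ℝ) - 1) / r * v' r + fder p (u r) * v r = 0

/-- `u` is decaying: `u(r) → 0` and `u'(r) → 0` as `r → ∞`. -/
def Decaying (u u' : ℝ → ℝ) : Prop :=
  Filter.Tendsto u Filter.atTop (nhds 0) ∧ Filter.Tendsto u' Filter.atTop (nhds 0)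

/-- `u` changes sign on `(0,∞)`. -/
def ChangesSign (u : ℝ → ℝ) : Prop :=
  (∃ r : ℝ, 0 < r ∧ u r < 0) ∧ (∃ r : ℝ, 0 < r ∧ 0 < u r)

/-- `z 0 < z 1 < ⋯ < z (k-1)` are exactly the zeros of `u` in `(0,∞)`. -/
def ExactZeros (u : ℝ → ℝ) (k : ℕ) (z : Fin k → ℝ) : Prop :=
  StrictMono z ∧ (∀ i, 0 < z i ∧ u (z i) = 0) ∧
    ∀ r : ℝ, 0 < r → u r = 0 → ∃ i, r = z i

lemma f_pos_of_F_nonneg {p s : ℝ} (hp : 1 < p) (hs : 0 < s) (hF : 0 ≤ F p s) : 0 < f p s := by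
  have hmul : s ^ (p + 1) = s ^ (p - 1) * s ^ 2 := by
    rw [← Real.rpow_natCast, ← Real.rpow_add hs]
    congr 1
    push_cast
    ring
  unfold F at hF
  unfold f
  rw [abs_of_pos hs] at hF ⊢
  rw [hmul] at hF
  have hfac : 0 ≤ (s ^ 2 / (p + 1)) * (s ^ (p - 1) - (p + 1) / 2) := by
    convert hF using 1
    field_simp
    ring
  have hlarge : 0 ≤ s ^ (p - 1) - (p + 1) / 2 :=
    nonneg_of_mul_nonneg_right hfac (by positivity)
  nlinarith

lemma hasDerivAt_energy {n : ℕ} {p α : ℝ} {u u' u'' : ℝ → ℝ} (hp : 1 < p)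
    (hu : IsSolution n p α u u' u'') (hpos : ∀ r : ℝ, 0 ≤ r → 0 < u r) {r : ℝ} (hr : 0 < r) :
    HasDerivAt (fun t => u' t ^ 2 / 2 + (-u t ^ 2 / 2 + u t ^ (p + 1) / (p + 1)))
      (-(((n : ℝ) - 1) / r * u' r ^ 2)) r := by
  have h1 := (hu.hasDeriv1 r hr.le).hasDerivAt (Ici_mem_nhds hr)
  have h2 := (hu.hasDeriv2 r hr.le).hasDerivAt (Ici_mem_nhds hr)
  have hur := hpos r hr.le
  have h3 := h1.rpow_const (p := p + 1) (Or.inl hur.ne')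
  have hE := ((h2.fun_pow 2).div_const 2).add
    (((h1.fun_pow 2).fun_neg.div_const 2).add (h3.div_const (p + 1)))
  refine hE.congr_deriv ?_
  have hode := hu.ode r hr
  have hp0 : p + 1 ≠ 0 := by linarith
  have hmul : u r ^ p = u r ^ (p - 1) * u r := by
    rw [Real.rpow_sub_one hur.ne', div_mul_cancel₀ _ hur.ne']
  unfold f at hode
  rw [abs_of_pos hur] at hode
  have hu'' : u'' r = -(((n : ℝ) - 1) / r * u' r) + u r - u r ^ (p - 1) * u r := by linarith
  rw [add_sub_cancel_right, hmul, hu'']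
  field_simp
  push_cast
  ring

lemma F_nonneg_of_deriv_eq_zero {n : ℕ} (hn : 1 ≤ n) {p α : ℝ} {u u' u'' : ℝ → ℝ} (hp : 1 < p)
    (hu : IsSolution n p α u u' u'') (hdec : Decaying u u') (hpos : ∀ r : ℝ, 0 ≤ r → 0 < u r)
    {r : ℝ} (hr : 0 ≤ r) (hcrit : u' r = 0) : 0 ≤ F p (u r) := by
  have hp0 : 0 < p + 1 := by linarith
  have hn' : (1 : ℝ) ≤ n := by exact_mod_cast hn
  set E : ℝ → ℝ := fun t => u' t ^ 2 / 2 + (-u t ^ 2 / 2 + u t ^ (p + 1) / (p + 1)) with hEdef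
  have hcu : ContinuousOn u (Ici 0) := fun t ht => (hu.hasDeriv1 t ht).continuousWithinAt
  have hcu' : ContinuousOn u' (Ici 0) := fun t ht => (hu.hasDeriv2 t ht).continuousWithinAt
  have hanti : AntitoneOn E (Ici 0) := by
    refine antitoneOn_of_deriv_nonpos (convex_Ici 0) ?_ ?_ ?_
    · exact ((hcu'.pow 2).div_const 2).add (((hcu.pow 2).neg.div_const 2).add
        ((hcu.rpow_const fun t _ => Or.inr hp0.le).div_const (p + 1)))
    · rw [interior_Ici]
      exact fun t ht => (hasDerivAt_energy hp hu hpos ht).differentiableAt.differentiableWithinAt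
    · rw [interior_Ici]
      intro t ht
      rw [(hasDerivAt_energy hp hu hpos ht).deriv]
      have ht0 : (0 : ℝ) < t := ht
      have : 0 ≤ ((n : ℝ) - 1) / t := div_nonneg (by linarith) ht0.le
      nlinarith [mul_nonneg this (sq_nonneg (u' t))]
  have hlim : Tendsto E atTop (nhds 0) := by
    have h := ((hdec.2.pow 2).div_const 2).add (((hdec.1.pow 2).neg.div_const 2).add
      ((hdec.1.rpow_const (p := p + 1) (Or.inr hp0.le)).div_const (p + 1)))
    simpa [Real.zero_rpow hp0.ne'] using h
  have hEr : 0 ≤ E r := by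
    refine le_of_tendsto hlim ?_
    filter_upwards [eventually_ge_atTop r] with t ht
    exact hanti hr (hr.trans ht) ht
  simpa [hEdef, F, hcrit, abs_of_pos (hpos r hr)] using hEr

lemma mul_secondDeriv_zero {n : ℕ} {p α : ℝ} {u u' u'' : ℝ → ℝ} (hp : 1 < p)
    (hu : IsSolution n p α u u' u'') : (n : ℝ) * u'' 0 + f p (u 0) = 0 := by
  have h0 : (0 : ℝ) ∈ Ici (0 : ℝ) := self_mem_Ici
  have hsub : Ioi (0 : ℝ) ⊆ Ici 0 := Ioi_subset_Ici_self
  have hf : Continuous (f p) := by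
    unfold f
    exact continuous_neg.add
      ((continuous_abs.rpow_const fun _ => Or.inr (by linarith)).mul continuous_id)
  have hu2 : Tendsto u'' (nhdsWithin 0 (Ioi 0)) (nhds (u'' 0)) := (hu.cont2 0 h0).mono hsub
  have hfu : Tendsto (fun r => f p (u r)) (nhdsWithin 0 (Ioi 0)) (nhds (f p (u 0))) :=
    (hf.tendsto _).comp ((hu.hasDeriv1 0 h0).continuousWithinAt.mono hsub)
  have hslope : Tendsto (slope u' 0) (nhdsWithin 0 (Ioi 0)) (nhds (u'' 0)) :=
    (hasDerivWithinAt_iff_tendsto_slope' self_notMem_Ioi).1 ((hu.hasDeriv2 0 h0).mono hsub)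
  have hlim := (hu2.add (hslope.const_mul ((n : ℝ) - 1))).add hfu
  have hzero : Tendsto (fun _ : ℝ => (0 : ℝ)) (nhdsWithin 0 (Ioi 0))
      (nhds (u'' 0 + ((n : ℝ) - 1) * u'' 0 + f p (u 0))) := by
    refine hlim.congr' ?_
    filter_upwards [self_mem_nhdsWithin] with r hr
    refine Eq.trans ?_ (hu.ode r hr)
    rw [slope_def_field, hu.initDeriv]
    ring
  have h := tendsto_nhds_unique hzero tendsto_const_nhds
  linarith

lemma secondDeriv_neg_of_deriv_eq_zero {n : ℕ} (hn : 1 ≤ n) {p α : ℝ} {u u' u'' : ℝ → ℝ}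
    (hp : 1 < p) (hu : IsSolution n p α u u' u'') (hdec : Decaying u u')
    (hpos : ∀ r : ℝ, 0 ≤ r → 0 < u r) {r : ℝ} (hr : 0 ≤ r) (hcrit : u' r = 0) : u'' r < 0 := by
  have hf := f_pos_of_F_nonneg hp (hpos r hr)
    (F_nonneg_of_deriv_eq_zero hn hp hu hdec hpos hr hcrit)
  rcases hr.eq_or_lt with rfl | hr
  · have h := mul_secondDeriv_zero hp hu
    have hn' : (0 : ℝ) < n := by exact_mod_cast hn
    by_contra! hge
    nlinarith [mul_nonneg hn'.le hge]
  · have h := hu.ode r hr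
    rw [hcrit, mul_zero] at h
    linarith

/-- A function vanishing at `0` whose derivative is negative at each of its zeros is negative
on `(0,∞)`. -/
lemma neg_of_deriv_neg_at_zeros {g g' : ℝ → ℝ} (h0 : g 0 = 0)
    (hg : ∀ r ∈ Ici (0 : ℝ), HasDerivWithinAt g (g' r) (Ici 0) r)
    (hneg : ∀ r, 0 ≤ r → g r = 0 → g' r < 0) {r : ℝ} (hr : 0 < r) : g r < 0 := by
  have hcont : ContinuousOn g (Ici 0) := fun t ht => (hg t ht).continuousWithinAt
  have hle : ∀ x ∈ Icc 0 r, g x ≤ 0 := by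
    refine image_le_of_liminf_slope_right_lt_deriv_boundary' (f := g) (f' := g') (B := fun _ => 0)
      (B' := fun _ => 0) (hcont.mono Icc_subset_Ici_self) ?_ h0.le continuousOn_const
      (fun x _ => hasDerivWithinAt_const _ _ _) (fun x hx hgx => hneg x hx.1 hgx)
    intro x hx s hs
    exact ((hg x hx.1).mono (Ici_subset_Ici.2 hx.1)).liminf_right_slope_le hs
  refine (hle r ⟨hr.le, le_rfl⟩).lt_of_ne fun hgr => ?_
  have hd : HasDerivWithinAt g (g' r) (Iio r) r :=
    ((hg r hr.le).hasDerivAt (Ici_mem_nhds hr)).hasDerivWithinAt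
  have hslope := (hasDerivWithinAt_iff_tendsto_slope' self_notMem_Iio).1 hd
  refine (hneg r hr.le hgr).not_ge (ge_of_tendsto hslope ?_)
  filter_upwards [Ioo_mem_nhdsLT hr] with x hx
  rw [slope_def_field, hgr]
  exact div_nonneg_of_nonpos (by linarith [hle x ⟨hx.1.le, hx.2.le⟩]) (by linarith [hx.2])

/-- a ground state is strictly decreasing. -/
theorem statement8 (n : ℕ) (hn : 3 ≤ n) (p : ℝ) (hp1 : 1 < p)
    (hp2 : p < ((n : ℝ) + 2) / ((n : ℝ) - 2))
    (α : ℝ) (hα : 0 < α)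
    (u u' u'' : ℝ → ℝ) (hu : IsSolution n p α u u' u'')
    (hdec : Decaying u u') (hpos : ∀ r : ℝ, 0 ≤ r → 0 < u r) :
    ∀ r : ℝ, 0 < r → u' r < 0 := by
  exact fun r hr => neg_of_deriv_neg_at_zeros hu.initDeriv hu.hasDeriv2
    (fun t ht hcrit =>
      secondDeriv_neg_of_deriv_eq_zero (by omega) hp1 hu hdec hpos ht hcrit) hr
end

section
/- Let u be a solution of the IVP that changes sign with exactly k ≥ 1 zeros z₁ < z₂ < ⋯ < z_k. Then u' < 0 on (0, z₁), and u has exactly k − 1 critical points c₁ < c₂ < ⋯ < c_{k−1} in (z₁, z_k), with c_i ∈ (z_i, z_{i+1}) for 1 ≤ i ≤ k−1, and u(0) > |u(c₁)| > ⋯ > |u(c_{k−1})| > α_*, where α_* = ((p+1)/2)^{1/(p−1)}. If moreover u is a bound state, then u has a unique critical point c_k in (z_k, ∞), and |u(c_{k−1})| > |u(c_k)| > α_*. -/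
open Real Filter Set

theorem F_neg (p s : ℝ) : F p (-s) = F p s := by simp [F]

theorem f_neg (p s : ℝ) : f p (-s) = -f p s := by simp only [f, abs_neg]; ring

theorem F_eq_mul {p : ℝ} (hp : 1 < p) (s : ℝ) :
    F p s = |s| ^ 2 * (|s| ^ (p - 1) / (p + 1) - 1 / 2) := by
  rcases eq_or_ne s 0 with rfl | hs
  · simp [F, Real.zero_rpow (by linarith : p + 1 ≠ 0)]
  · have h : |s| ^ (p + 1) = |s| ^ (p - 1) * |s| ^ 2 := by
      rw [← Real.rpow_natCast, ← Real.rpow_add (abs_pos.2 hs)]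
      congr 1; push_cast; ring
    rw [F, h, ← sq_abs s]; ring

theorem hasDerivAt_F {p : ℝ} (hp : 1 < p) (s : ℝ) : HasDerivAt (F p) (f p s) s := by
  have h1 := (hasDerivAt_abs_rpow s (by linarith : (1 : ℝ) < p + 1)).div_const (p + 1)
  have h2 := (((hasDerivAt_id s).pow 2).neg.div_const 2).add h1
  refine h2.congr_deriv ?_
  have h3 : p + 1 - 2 = p - 1 := by ring
  have : p + 1 ≠ 0 := by linarith
  rw [h3, f]; field_simp; simp; ring

theorem continuous_f {p : ℝ} (hp : 1 < p) : Continuous (f p) := by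
  have : Continuous fun s : ℝ => |s| ^ (p - 1) :=
    continuous_abs.rpow_const fun _ => Or.inr (by linarith)
  unfold f; fun_prop

theorem one_lt_threshold {p : ℝ} (hp : 1 < p) : 1 < ((p + 1) / 2) ^ (1 / (p - 1)) :=
  Real.one_lt_rpow (by linarith) (by apply one_div_pos.2; linarith)

theorem threshold_lt_abs {p s : ℝ} (hp : 1 < p) (h : 0 < F p s) :
    ((p + 1) / 2) ^ (1 / (p - 1)) < |s| := by
  rw [F_eq_mul hp] at h
  have h1 : 0 < |s| ^ (p - 1) / (p + 1) - 1 / 2 := pos_of_mul_pos_right h (sq_nonneg _)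
  have h2 : (p + 1) / 2 < |s| ^ (p - 1) := by
    have := (lt_div_iff₀ (by linarith : 0 < p + 1)).1 (sub_pos.1 h1)
    linarith
  have h3 := Real.rpow_lt_rpow (by linarith) h2 (by apply one_div_pos.2; linarith : 0 < 1 / (p - 1))
  rwa [← Real.rpow_mul (abs_nonneg _), mul_one_div_cancel (by linarith), Real.rpow_one] at h3

theorem F_neg_of_abs_lt_one {p s : ℝ} (hp : 1 < p) (h0 : s ≠ 0) (h1 : |s| < 1) : F p s < 0 := by
  rw [F_eq_mul hp]
  have h2 : |s| ^ (p - 1) ≤ 1 := Real.rpow_le_one (abs_nonneg _) h1.le (by linarith)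
  apply mul_neg_of_pos_of_neg (by positivity)
  rw [sub_neg, div_lt_iff₀ (by linarith)]; linarith

theorem abs_lt_abs_of_F_lt {p s t : ℝ} (hp : 1 < p) (h0 : 0 < F p s) (h : F p s < F p t) :
    |s| < |t| := by
  by_contra! hts
  rw [F_eq_mul hp] at h h0
  rw [F_eq_mul hp t] at h
  have h1 : |t| ^ (p - 1) ≤ |s| ^ (p - 1) := Real.rpow_le_rpow (abs_nonneg _) hts (by linarith)
  have h2 : |t| ^ (p - 1) / (p + 1) ≤ |s| ^ (p - 1) / (p + 1) := by
    apply div_le_div_of_nonneg_right h1; linarith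
  have h3 : 0 < |s| ^ (p - 1) / (p + 1) - 1 / 2 := pos_of_mul_pos_right h0 (sq_nonneg _)
  have h4 : |t| ^ 2 ≤ |s| ^ 2 := pow_le_pow_left₀ (abs_nonneg _) hts 2
  nlinarith [sq_nonneg |t|]

theorem f_pos_of_one_lt {p s : ℝ} (hp : 1 < p) (h : 1 < s) : 0 < f p s := by
  have h1 : 1 < |s| ^ (p - 1) := by
    rw [abs_of_pos (by linarith)]; exact Real.one_lt_rpow h (by linarith)
  unfold f; nlinarith

/-- A function with strictly negative derivative at each of its zeros cannot return to zero. -/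
theorem neg_of_deriv_neg_at_zeros_s9 {g g' : ℝ → ℝ} {a b : ℝ}
    (hc : ContinuousOn g (Ico a b)) (ha : g a = 0)
    (hd : ∀ x ∈ Ico a b, HasDerivWithinAt g (g' x) (Ici x) x)
    (hd' : ∀ x ∈ Ioo a b, HasDerivAt g (g' x) x)
    (hz : ∀ x ∈ Ico a b, g x = 0 → g' x < 0) : ∀ x ∈ Ioo a b, g x < 0 := by
  have hle : ∀ x ∈ Ioo a b, g x ≤ 0 := by
    intro x hx
    refine image_le_of_deriv_right_lt_deriv_boundary (f := g) (f' := g') (a := a) (b := x)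
      (B := fun _ => 0) (B' := fun _ => 0)
      (hc.mono fun y hy => ⟨hy.1, hy.2.trans_lt hx.2⟩)
      (fun y hy => hd y ⟨hy.1, hy.2.trans hx.2⟩) ha.le
      (fun y => hasDerivAt_const y 0)
      (fun y hy h => hz y ⟨hy.1, hy.2.trans hx.2⟩ h) ⟨hx.1.le, le_rfl⟩
  intro x hx
  refine lt_of_le_of_ne (hle x hx) fun h0 => ?_
  have hmax : IsLocalMax g x := by
    filter_upwards [Ioo_mem_nhds hx.1 hx.2] with y hy
    rw [h0]; exact hle y hy
  have := hmax.hasDerivAt_eq_zero (hd' x hx)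
  exact absurd (hz x ⟨hx.1.le, hx.2⟩ h0) (by rw [this]; exact lt_irrefl 0)

/-- The energy `u'^2/2 + F(u)`. -/
noncomputable def energy (p : ℝ) (u u' : ℝ → ℝ) (r : ℝ) : ℝ := u' r ^ 2 / 2 + F p (u r)

theorem energy_eq_of_deriv_eq_zero {p : ℝ} {u u' : ℝ → ℝ} {r : ℝ} (h : u' r = 0) :
    energy p u u' r = F p (u r) := by simp [energy, h]

namespace IsSolution

variable {n : ℕ} {p α : ℝ} {u u' u'' : ℝ → ℝ}

theorem neg (hu : IsSolution n p α u u' u'') :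
    IsSolution n p (-α) (fun r => -u r) (fun r => -u' r) (fun r => -u'' r) where
  init := by simp [hu.init]
  initDeriv := by simp [hu.initDeriv]
  hasDeriv1 r hr := (hu.hasDeriv1 r hr).neg
  hasDeriv2 r hr := (hu.hasDeriv2 r hr).neg
  cont2 := hu.cont2.neg
  ode r hr := by rw [f_neg]; linarith [hu.ode r hr]

theorem hasDerivAt (hu : IsSolution n p α u u' u'') {r : ℝ} (hr : 0 < r) :
    HasDerivAt u (u' r) r := (hu.hasDeriv1 r hr.le).hasDerivAt (Ici_mem_nhds hr)

theorem hasDerivAt' (hu : IsSolution n p α u u' u'') {r : ℝ} (hr : 0 < r) :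
    HasDerivAt u' (u'' r) r := (hu.hasDeriv2 r hr.le).hasDerivAt (Ici_mem_nhds hr)

theorem continuousOn (hu : IsSolution n p α u u' u'') : ContinuousOn u (Ici 0) :=
  fun r hr => (hu.hasDeriv1 r hr).continuousWithinAt

theorem continuousOn' (hu : IsSolution n p α u u' u'') : ContinuousOn u' (Ici 0) :=
  fun r hr => (hu.hasDeriv2 r hr).continuousWithinAt

theorem tendsto_nhdsGT_zero (hu : IsSolution n p α u u' u'') :
    Tendsto u (nhdsWithin 0 (Ioi 0)) (nhds α) := by
  have := (hu.continuousOn 0 self_mem_Ici).mono_left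
    (nhdsWithin_mono _ (Ioi_subset_Ici_self (a := (0 : ℝ))))
  rwa [hu.init] at this

theorem second_deriv_zero (hp : 1 < p) (hu : IsSolution n p α u u' u'') :
    n * u'' 0 + f p α = 0 := by
  have h1 : Tendsto u'' (nhdsWithin 0 (Ioi 0)) (nhds (u'' 0)) :=
    (hu.cont2 0 self_mem_Ici).mono_left (nhdsWithin_mono _ Ioi_subset_Ici_self)
  have h2 := hu.tendsto_nhdsGT_zero
  have h3 : Tendsto (fun r => u' r / r) (nhdsWithin 0 (Ioi 0)) (nhds (u'' 0)) := by
    have := (hasDerivWithinAt_iff_tendsto_slope.1 (hu.hasDeriv2 0 self_mem_Ici))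
    rw [Ici_sdiff_left] at this
    refine this.congr fun r => ?_
    simp [slope_def_field, hu.initDeriv]
  have h4 : Tendsto (fun r => u'' r + ((n : ℝ) - 1) * (u' r / r) + f p (u r))
      (nhdsWithin 0 (Ioi 0)) (nhds (u'' 0 + ((n : ℝ) - 1) * u'' 0 + f p α)) :=
    (h1.add (h3.const_mul _)).add (((continuous_f hp).tendsto α).comp h2)
  have h5 : Tendsto (fun r => u'' r + ((n : ℝ) - 1) * (u' r / r) + f p (u r))
      (nhdsWithin 0 (Ioi 0)) (nhds 0) := by
    refine tendsto_const_nhds.congr' ?_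
    filter_upwards [self_mem_nhdsWithin] with r hr
    rw [← hu.ode r hr]; ring
  linarith [tendsto_nhds_unique h4 h5]

theorem second_deriv_neg (hn : 3 ≤ n) (hp : 1 < p) (hu : IsSolution n p α u u' u'')
    {r : ℝ} (hr : 0 ≤ r) (h' : u' r = 0) (h1 : 1 < u r) : u'' r < 0 := by
  have hf := f_pos_of_one_lt hp h1
  rcases hr.eq_or_lt with rfl | hr
  · have h := hu.second_deriv_zero hp
    rw [hu.init] at hf
    have hn' : (0 : ℝ) < n := by positivity
    by_contra! h0
    have := mul_nonneg hn'.le h0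
    linarith
  · have := hu.ode r hr
    rw [h'] at this
    linarith

theorem hasDerivAt_energy (hp : 1 < p) (hu : IsSolution n p α u u' u'') {r : ℝ} (hr : 0 < r) :
    HasDerivAt (energy p u u') (-((n : ℝ) - 1) / r * u' r ^ 2) r := by
  have h := (((hu.hasDerivAt' hr).pow 2).div_const 2).add
    ((hasDerivAt_F hp (u r)).comp r (hu.hasDerivAt hr))
  refine h.congr_deriv ?_
  have := hu.ode r hr
  have h2 : u'' r = -(((n : ℝ) - 1) / r * u' r + f p (u r)) := by linarith
  rw [h2]; simp; ring

theorem antitoneOn_energy (hn : 3 ≤ n) (hp : 1 < p) (hu : IsSolution n p α u u' u'') :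
    AntitoneOn (energy p u u') (Ici 0) := by
  have hF : Continuous (F p) := continuous_iff_continuousAt.2
    fun s => (hasDerivAt_F hp s).continuousAt
  refine antitoneOn_of_hasDerivWithinAt_nonpos (convex_Ici 0)
    (f' := fun r => -((n : ℝ) - 1) / r * u' r ^ 2) ?_ ?_ ?_
  · exact ((hu.continuousOn'.pow 2).div_const 2).add (hF.comp_continuousOn hu.continuousOn)
  · intro r hr
    rw [interior_Ici] at hr
    exact (hu.hasDerivAt_energy hp hr).hasDerivWithinAt
  · intro r hr
    rw [interior_Ici] at hr
    have h3 : (3 : ℝ) ≤ n := by exact_mod_cast hn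
    have : 0 ≤ ((n : ℝ) - 1) / r * u' r ^ 2 :=
      mul_nonneg (div_nonneg (by linarith) (le_of_lt hr)) (sq_nonneg _)
    rw [neg_div, neg_mul]; linarith

theorem energy_lt (hn : 3 ≤ n) (hp : 1 < p) (hu : IsSolution n p α u u' u'') {a w b : ℝ}
    (ha : 0 ≤ a) (haw : a < w) (hwb : w < b) (hw : u' w ≠ 0) :
    energy p u u' b < energy p u u' a := by
  have hanti := hu.antitoneOn_energy hn hp
  by_contra! hle
  have hconst : energy p u u' =ᶠ[nhds w] fun _ => energy p u u' a := by
    filter_upwards [Ioo_mem_nhds haw hwb] with y hy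
    have hy0 : 0 ≤ y := ha.trans hy.1.le
    exact le_antisymm (hanti ha hy0 hy.1.le)
      (hle.trans (hanti hy0 (hy0.trans hy.2.le) hy.2.le))
  have hw0 : 0 < w := ha.trans_lt haw
  have h := (hu.hasDerivAt_energy hp hw0).unique
    ((hasDerivAt_const w (energy p u u' a)).congr_of_eventuallyEq hconst)
  have h3 : (3 : ℝ) ≤ n := by exact_mod_cast hn
  have : 0 < ((n : ℝ) - 1) / w * u' w ^ 2 := by
    have : 0 < (n : ℝ) - 1 := by linarith
    positivity
  rw [neg_div, neg_mul] at h; linarith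

/-- Zeros of a nontrivial solution are simple. -/
theorem deriv_ne_zero_of_eq_zero (hn : 3 ≤ n) (hp : 1 < p) (hα : α ≠ 0)
    (hu : IsSolution n p α u u' u'') {z : ℝ} (hz : 0 < z) (h0 : u z = 0) : u' z ≠ 0 := by
  intro h0'
  have hn1 : (0 : ℝ) ≤ (n : ℝ) - 1 := by
    have : (3 : ℝ) ≤ n := by exact_mod_cast hn
    linarith
  have hcont : ContinuousOn (fun r => |u r| ^ (p - 1)) (Icc 0 z) :=
    ((hu.continuousOn.mono Icc_subset_Ici_self).abs).rpow_const fun _ _ => Or.inr (by linarith)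
  obtain ⟨M, hM⟩ := isCompact_Icc.bddAbove_image hcont
  have hM' : ∀ r ∈ Icc 0 z, |u r| ^ (p - 1) ≤ M := fun r hr => hM (mem_image_of_mem _ hr)
  have hM0 : 0 ≤ M := (by positivity : (0 : ℝ) ≤ |u 0| ^ (p - 1)).trans
    (hM' 0 ⟨le_rfl, hz.le⟩)
  have key : ∀ ε ∈ Ioo 0 z, u ε = 0 := by
    intro ε hε
    set C : ℝ := 2 + M + 2 * ((n : ℝ) - 1) / ε with hC
    have hpos : ∀ r ∈ Icc ε z, 0 < r := fun r hr => hε.1.trans_le hr.1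
    have hder : ∀ r ∈ Icc ε z, HasDerivAt (fun r => (u r ^ 2 + u' r ^ 2) * Real.exp (C * r))
        ((2 * u r * u' r + 2 * u' r * u'' r) * Real.exp (C * r)
          + (u r ^ 2 + u' r ^ 2) * (Real.exp (C * r) * C)) r := by
      intro r hr
      have h1 := ((hu.hasDerivAt (hpos r hr)).pow 2).add ((hu.hasDerivAt' (hpos r hr)).pow 2)
      have h2 := ((hasDerivAt_id r).const_mul C).exp
      refine (h1.mul h2).congr_deriv ?_
      simp
    have hmono : MonotoneOn (fun r => (u r ^ 2 + u' r ^ 2) * Real.exp (C * r)) (Icc ε z) := by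
      refine monotoneOn_of_hasDerivWithinAt_nonneg (convex_Icc ε z)
        (fun r hr => (hder r hr).continuousAt.continuousWithinAt)
        (fun r hr => (hder r (interior_subset hr)).hasDerivWithinAt) ?_
      intro r hr
      replace hr := interior_subset hr
      have hr0 := hpos r hr
      have hu2 : u'' r = -(((n : ℝ) - 1) / r * u' r) + u r - |u r| ^ (p - 1) * u r := by
        have := hu.ode r hr0
        simp only [f] at this
        linarith
      have hA : ((n : ℝ) - 1) / r ≤ ((n : ℝ) - 1) / ε :=
        div_le_div_of_nonneg_left hn1 hε.1 hr.1
      have hB := hM' r ⟨hr0.le, hr.2⟩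
      have hB0 : 0 ≤ |u r| ^ (p - 1) := by positivity
      have hA0 : 0 ≤ ((n : ℝ) - 1) / r := div_nonneg hn1 hr0.le
      have hC' : C = 2 + M + 2 * (((n : ℝ) - 1) / ε) := by rw [hC]; ring
      have hfac : 0 ≤ 2 * u r * u' r + 2 * u' r * u'' r + (u r ^ 2 + u' r ^ 2) * C := by
        rw [hu2, hC']
        generalize ((n : ℝ) - 1) / r = A at *
        generalize ((n : ℝ) - 1) / ε = A' at *
        generalize |u r| ^ (p - 1) = B at *
        generalize u r = x at *
        generalize u' r = y at *
        nlinarith [mul_nonneg hB0 (sq_nonneg (x - y)), mul_nonneg hB0 (sq_nonneg (x + y)),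
          mul_nonneg (sub_nonneg.2 hB) (add_nonneg (sq_nonneg x) (sq_nonneg y)),
          mul_nonneg (sub_nonneg.2 hA) (sq_nonneg y), sq_nonneg (x + y),
          mul_nonneg (hA0.trans hA) (sq_nonneg x)]
      have := mul_nonneg hfac (Real.exp_pos (C * r)).le
      linarith
    have h := hmono (left_mem_Icc.2 hε.2.le) (right_mem_Icc.2 hε.2.le) hε.2.le
    simp only [h0, h0'] at h
    have h1 : (u ε ^ 2 + u' ε ^ 2) * Real.exp (C * ε) ≤ 0 := by simpa using h
    have h2 : u ε ^ 2 + u' ε ^ 2 ≤ 0 := nonpos_of_mul_nonpos_left h1 (Real.exp_pos _)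
    nlinarith [sq_nonneg (u ε), sq_nonneg (u' ε)]
  have hlim := hu.tendsto_nhdsGT_zero
  have hlim0 : Tendsto u (nhdsWithin 0 (Ioi 0)) (nhds 0) := by
    refine tendsto_const_nhds.congr' ?_
    filter_upwards [Ioo_mem_nhdsGT hz] with r hr
    exact (key r hr).symm
  exact hα (tendsto_nhds_unique hlim hlim0)

theorem energy_pos_of_eq_zero (hn : 3 ≤ n) (hp : 1 < p) (hα : α ≠ 0)
    (hu : IsSolution n p α u u' u'') {z : ℝ} (hz : 0 < z) (h0 : u z = 0) :
    0 < energy p u u' z := by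
  have h := hu.deriv_ne_zero_of_eq_zero hn hp hα hz h0
  have hF : F p 0 = 0 := by simp [F_eq_mul hp]
  rw [energy, h0, hF]; positivity

theorem deriv_neg_of_pos (hn : 3 ≤ n) (hp : 1 < p) (hu : IsSolution n p α u u' u'') {c b : ℝ}
    (hc : 0 ≤ c) (hc' : u' c = 0) (hpos : ∀ x ∈ Ico c b, 0 < u x)
    (hE : ∀ x ∈ Ico c b, 0 < energy p u u' x) : ∀ x ∈ Ioo c b, u' x < 0 := by
  refine neg_of_deriv_neg_at_zeros_s9 (g' := u'')
    (hu.continuousOn'.mono fun x hx => hc.trans hx.1) hc'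
    (fun x hx => (hu.hasDeriv2 x (hc.trans hx.1)).mono (Ici_subset_Ici.2 (hc.trans hx.1)))
    (fun x hx => hu.hasDerivAt' (hc.trans_lt hx.1)) ?_
  intro x hx h0
  refine hu.second_deriv_neg hn hp (hc.trans hx.1) h0 ?_
  have h := hE x hx
  rw [energy_eq_of_deriv_eq_zero h0] at h
  have := (one_lt_threshold hp).trans (threshold_lt_abs hp h)
  rwa [abs_of_pos (hpos x hx)] at this

theorem sign_of_ne_zero (hu : IsSolution n p α u u' u'') {s : Set ℝ} (hs : s ⊆ Ici 0)
    (hconn : s.OrdConnected) (h : ∀ x ∈ s, u x ≠ 0) :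
    (∀ x ∈ s, 0 < u x) ∨ ∀ x ∈ s, u x < 0 := by
  by_contra! hcon
  obtain ⟨⟨x, hx, hx0⟩, y, hy, hy0⟩ := hcon
  obtain ⟨w, hw, hw0⟩ := hconn.isPreconnected.intermediate_value hx hy (hu.continuousOn.mono hs)
    ⟨hx0, hy0⟩
  exact h w hw hw0

theorem deriv_ne_zero_of_ne_zero (hn : 3 ≤ n) (hp : 1 < p) (hu : IsSolution n p α u u' u'')
    {c b : ℝ} (hc : 0 ≤ c) (hc' : u' c = 0) (hne : ∀ x ∈ Ico c b, u x ≠ 0)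
    (hE : ∀ x ∈ Ico c b, 0 < energy p u u' x) : ∀ x ∈ Ioo c b, u' x ≠ 0 := by
  intro x hx
  rcases hu.sign_of_ne_zero (fun y hy => hc.trans hy.1) ordConnected_Ico hne with h | h
  · exact (hu.deriv_neg_of_pos hn hp hc hc' h hE x hx).ne
  · have := hu.neg.deriv_neg_of_pos hn hp (b := b) hc (by simp [hc'])
      (fun y hy => neg_pos.2 (h y hy))
      (fun y hy => by simpa [energy, F_neg] using hE y hy) x hx
    exact (neg_lt_zero.1 this).ne'

theorem critical_unique (hn : 3 ≤ n) (hp : 1 < p) (hu : IsSolution n p α u u' u'')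
    {s : Set ℝ} (hs : s ⊆ Ici 0) (hopen : IsOpen s) (hconn : s.OrdConnected)
    (hne : ∀ x ∈ s, u x ≠ 0) (hE : ∀ x ∈ s, 0 < energy p u u' x) {c d : ℝ} (hc : c ∈ s)
    (hd : d ∈ s) (hc' : u' c = 0) (hd' : u' d = 0) : c = d := by
  wlog hcd : c < d generalizing c d
  · rcases (not_lt.1 hcd).eq_or_lt with h | h
    · exact h.symm
    · exact (this hd hc hd' hc' h).symm
  obtain ⟨b, hb, hbs⟩ := mem_nhdsGE_iff_exists_Ico_subset.1
    (mem_nhdsWithin_of_mem_nhds (hopen.mem_nhds hd))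
  have hsub : Ico c b ⊆ s := by
    intro x hx
    rcases le_total x d with h | h
    · exact hconn.out hc hd ⟨hx.1, h⟩
    · exact hbs ⟨h, hx.2⟩
  exact absurd hd' (hu.deriv_ne_zero_of_ne_zero hn hp (hs hc) hc' (fun x hx => hne x (hsub hx))
    (fun x hx => hE x (hsub hx)) d ⟨hcd, hb⟩)

/-- A critical point where the energy is positive has larger amplitude than any later one,
provided the solution vanishes in between. -/
theorem abs_lt_of_zero_between (hn : 3 ≤ n) (hp : 1 < p) (hα : α ≠ 0)
    (hu : IsSolution n p α u u' u'') {c z d : ℝ} (hc : 0 ≤ c) (hcz : c < z) (hzd : z < d)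
    (hz : u z = 0) (hc' : u' c = 0) (hd' : u' d = 0) (hE : 0 < energy p u u' d) :
    |u d| < |u c| := by
  have h := hu.energy_lt hn hp hc hcz hzd
    (hu.deriv_ne_zero_of_eq_zero hn hp hα (hc.trans_lt hcz) hz)
  rw [energy_eq_of_deriv_eq_zero hd'] at h hE
  rw [energy_eq_of_deriv_eq_zero hc'] at h
  exact abs_lt_abs_of_F_lt hp hE h

theorem exists_critical_of_tendsto (hu : IsSolution n p α u u' u'') {z : ℝ} (hz : 0 < z)
    (h0 : u z = 0) (hpos : ∀ x, z < x → 0 < u x) (hlim : Tendsto u atTop (nhds 0)) :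
    ∃ c, z < c ∧ u' c = 0 := by
  obtain ⟨Y, hYy, hY⟩ := ((hlim.eventually_lt_const (hpos (z + 1) (by linarith))).and
    (eventually_gt_atTop (z + 1))).exists
  obtain ⟨a, ha, haY⟩ := intermediate_value_Ioo (by linarith : z ≤ z + 1)
    (hu.continuousOn.mono fun x hx => hz.le.trans hx.1)
    (⟨by rw [h0]; exact hpos Y (by linarith), hYy⟩ : u Y ∈ Ioo (u z) (u (z + 1)))
  have haY' : a < Y := ha.2.trans hY
  obtain ⟨c, hc, hc0⟩ := exists_hasDerivAt_eq_zero (f' := u') haY'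
    (hu.continuousOn.mono fun x hx => (hz.trans ha.1).le.trans hx.1) haY
    (fun x hx => hu.hasDerivAt ((hz.trans ha.1).trans hx.1))
  exact ⟨c, ha.1.trans hc.1, hc0⟩

theorem energy_pos_of_decaying (hn : 3 ≤ n) (hp : 1 < p) (hu : IsSolution n p α u u' u'')
    (hd : Decaying u u') {z : ℝ} (hne : ∀ x, z < x → u x ≠ 0) {x : ℝ} (hx : 0 ≤ x) :
    0 < energy p u u' x := by
  have hanti := hu.antitoneOn_energy hn hp
  have hlim : Tendsto (energy p u u') atTop (nhds 0) := by
    have h := ((hd.2.pow 2).div_const 2).add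
      ((hasDerivAt_F hp 0).continuousAt.tendsto.comp hd.1)
    have hF : F p 0 = 0 := by simp [F_eq_mul hp]
    unfold energy
    simpa [hF] using h
  have hnonneg : ∀ y, 0 ≤ y → 0 ≤ energy p u u' y := by
    intro y hy
    refine le_of_tendsto hlim ?_
    filter_upwards [eventually_ge_atTop y] with w hw
    exact hanti hy (hy.trans hw) hw
  have habs : Tendsto (fun r => |u r|) atTop (nhds 0) := by simpa using hd.1.abs
  obtain ⟨y, ⟨hy1, hyx⟩, hyz⟩ := (((habs.eventually_lt_const one_pos).and
    (eventually_gt_atTop x)).and (eventually_gt_atTop z)).exists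
  have hy' : u' y ≠ 0 := by
    intro h
    have h1 := hnonneg y (hx.trans hyx.le)
    rw [energy_eq_of_deriv_eq_zero h] at h1
    exact absurd (F_neg_of_abs_lt_one hp (hne y hyz) hy1) (not_lt.2 h1)
  exact (hnonneg (y + 1) (by linarith)).trans_lt
    (hu.energy_lt hn hp hx hyx (lt_add_one y) hy')

theorem exists_critical_of_decaying (hu : IsSolution n p α u u' u'') {z : ℝ} (hz : 0 < z)
    (h0 : u z = 0) (hne : ∀ x, z < x → u x ≠ 0) (hlim : Tendsto u atTop (nhds 0)) :
    ∃ c, z < c ∧ u' c = 0 := by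
  rcases hu.sign_of_ne_zero (fun y (hy : y ∈ Ioi z) => (hz.trans hy).le) ordConnected_Ioi hne
    with h | h
  · exact hu.exists_critical_of_tendsto hz h0 h hlim
  · obtain ⟨c, hc, hc'⟩ := hu.neg.exists_critical_of_tendsto hz (by simp [h0])
      (fun x hx => neg_pos.2 (h x hx)) (by simpa using hlim.neg)
    exact ⟨c, hc, neg_eq_zero.1 hc'⟩

end IsSolution

theorem exists_consecutive_of_between {k : ℕ} {z : Fin k → ℝ} (hk : 0 < k)
    {r : ℝ} (h0 : z ⟨0, hk⟩ < r) (hr : ∀ i, r ≠ z i) :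
    ∀ j (hj : j < k), r < z ⟨j, hj⟩ →
      ∃ i, ∃ hi : i + 1 < k, z ⟨i, by omega⟩ < r ∧ r < z ⟨i + 1, hi⟩ := by
  intro j
  induction j with
  | zero => intro hj h; exact absurd h h0.not_gt
  | succ j ih =>
    intro hj h
    rcases (hr ⟨j, by omega⟩).lt_or_gt with h1 | h1
    · exact ih _ h1
    · exact ⟨j, hj, h1, h⟩


/-- structure of the critical points of a nodal solution with exactly `k` zeros;
`c 0 < ⋯ < c (k-2)` are exactly the critical points in `(z₁, z_k)`, with
`u(0) > |u(c₁)| > ⋯ > |u(c_{k-1})| > α_*`, and for a bound state there is a unique further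
critical point `ck > z_k` with `|u(ck)| > α_*`. -/
theorem statement9 (n : ℕ) (hn : 3 ≤ n) (p : ℝ) (hp1 : 1 < p)
    (hp2 : p < ((n : ℝ) + 2) / ((n : ℝ) - 2))
    (α : ℝ) (hα : 0 < α)
    (u u' u'' : ℝ → ℝ) (hu : IsSolution n p α u u' u'')
    (hsign : ChangesSign u)
    (k : ℕ) (hk : 0 < k) (z : Fin k → ℝ) (hz : ExactZeros u k z) :
    (∀ r : ℝ, 0 < r → r < z ⟨0, hk⟩ → u' r < 0) ∧
    ∃ c : Fin (k - 1) → ℝ, StrictMono c ∧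
      (∀ i : Fin (k - 1),
        z ⟨(i : ℕ), by have := i.isLt; omega⟩ < c i ∧
        c i < z ⟨(i : ℕ) + 1, by have := i.isLt; omega⟩ ∧
        u' (c i) = 0 ∧
        ((p + 1) / 2) ^ (1 / (p - 1)) < |u (c i)| ∧ |u (c i)| < u 0) ∧
      (∀ i j : Fin (k - 1), i < j → |u (c j)| < |u (c i)|) ∧
      (∀ r : ℝ, z ⟨0, hk⟩ < r → r < z ⟨k - 1, by omega⟩ → u' r = 0 → ∃ i, r = c i) ∧
      (Decaying u u' →
        ∃ ck : ℝ, z ⟨k - 1, by omega⟩ < ck ∧ u' ck = 0 ∧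
          (∀ r : ℝ, z ⟨k - 1, by omega⟩ < r → u' r = 0 → r = ck) ∧
          ((p + 1) / 2) ^ (1 / (p - 1)) < |u ck| ∧ |u ck| < u 0 ∧
          ∀ i : Fin (k - 1), |u ck| < |u (c i)|) := by
  have hα' : α ≠ 0 := hα.ne'
  obtain ⟨hmono, hzero, hall⟩ := hz
  have hanti := hu.antitoneOn_energy hn hp1
  have hmle : ∀ i j : Fin k, (i : ℕ) ≤ j → z i ≤ z j := fun i j h => hmono.monotone h
  have hEz : ∀ (i : Fin k) (x : ℝ), 0 ≤ x → x ≤ z i → 0 < energy p u u' x := by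
    intro i x hx hxz
    exact (hu.energy_pos_of_eq_zero hn hp1 hα' (hzero i).1 (hzero i).2).trans_le
      (hanti hx (hzero i).1.le hxz)
  have hne : ∀ i (hi : i + 1 < k), ∀ x ∈ Ioo (z ⟨i, by omega⟩) (z ⟨i + 1, hi⟩), u x ≠ 0 := by
    intro i hi x hx h0
    obtain ⟨j, rfl⟩ := hall x ((hzero _).1.trans hx.1) h0
    have h1 := hmono.lt_iff_lt.1 hx.1
    have h2 := hmono.lt_iff_lt.1 hx.2
    simp only [Fin.lt_def] at h1 h2
    omega
  have hex : ∀ i : Fin (k - 1), ∃ c ∈ Ioo (z ⟨(i : ℕ), by have := i.isLt; omega⟩)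
      (z ⟨(i : ℕ) + 1, by have := i.isLt; omega⟩), u' c = 0 := by
    intro i
    exact exists_hasDerivAt_eq_zero (hmono (Nat.lt_succ_self _))
      (hu.continuousOn.mono fun x hx => (hzero _).1.le.trans hx.1)
      ((hzero _).2.trans (hzero _).2.symm)
      (fun x hx => hu.hasDerivAt ((hzero _).1.trans hx.1))
  choose c hc hc' using hex
  have hcpos : ∀ i, 0 < c i := fun i => (hzero _).1.trans (hc i).1
  have hcz : ∀ (i : Fin (k - 1)) (j : Fin k), (i : ℕ) + 1 ≤ j → c i < z j :=
    fun i j hij => (hc i).2.trans_le (hmle _ _ hij)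
  have hzc : ∀ (i : Fin (k - 1)) (j : Fin k), (j : ℕ) ≤ i → z j < c i :=
    fun i j hij => (hmle _ _ hij).trans_lt (hc i).1
  have hEc : ∀ i, 0 < energy p u u' (c i) := fun i => hEz _ _ (hcpos i).le (hc i).2.le
  have hEF : ∀ x, u' x = 0 → 0 < energy p u u' x →
      ((p + 1) / 2) ^ (1 / (p - 1)) < |u x| := by
    intro x hx h
    rw [energy_eq_of_deriv_eq_zero hx] at h
    exact threshold_lt_abs hp1 h
  have hu0 : |u 0| = u 0 := abs_of_pos (by rw [hu.init]; exact hα)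
  refine ⟨?_, c, ?_, ?_, ?_, ?_, ?_⟩
  · have hne0 : ∀ x ∈ Ico 0 (z ⟨0, hk⟩), u x ≠ 0 := by
      intro x hx h0
      rcases hx.1.eq_or_lt with rfl | hx0
      · exact hα' (hu.init ▸ h0)
      · obtain ⟨j, rfl⟩ := hall x hx0 h0
        exact absurd (hmono.lt_iff_lt.1 hx.2) (by simp [Fin.lt_def])
    have h0mem : (0 : ℝ) ∈ Ico 0 (z ⟨0, hk⟩) := ⟨le_rfl, (hzero _).1⟩
    have hpos : ∀ x ∈ Ico 0 (z ⟨0, hk⟩), 0 < u x := by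
      rcases hu.sign_of_ne_zero (fun y hy => hy.1) ordConnected_Ico hne0 with h | h
      · exact h
      · have := h 0 h0mem
        rw [hu.init] at this
        exact absurd hα this.not_gt
    intro r hr hrz
    exact hu.deriv_neg_of_pos hn hp1 le_rfl hu.initDeriv hpos
      (fun x hx => hEz _ x hx.1 hx.2.le) r ⟨hr, hrz⟩
  · intro i j hij
    exact (hc i).2.trans (hzc j _ hij)
  · intro i
    refine ⟨(hc i).1, (hc i).2, hc' i, hEF _ (hc' i) (hEc i), ?_⟩
    rw [← hu0]
    exact hu.abs_lt_of_zero_between hn hp1 hα' le_rfl (hzero _).1 (hc i).1 (hzero _).2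
      hu.initDeriv (hc' i) (hEc i)
  · intro i j hij
    exact hu.abs_lt_of_zero_between hn hp1 hα' (hcpos i).le (hc i).2 (hzc j _ hij) (hzero _).2
      (hc' i) (hc' j) (hEc j)
  · intro r hr0 hr1 hr'
    have hrpos : 0 < r := (hzero _).1.trans hr0
    have hrz : ∀ i, r ≠ z i := by
      rintro i rfl
      exact hu.deriv_ne_zero_of_eq_zero hn hp1 hα' hrpos (hzero i).2 hr'
    obtain ⟨i, hi, h1, h2⟩ := exists_consecutive_of_between hk hr0 hrz _ _ hr1
    refine ⟨⟨i, by omega⟩, ?_⟩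
    exact hu.critical_unique hn hp1 (s := Ioo (z ⟨i, by omega⟩) (z ⟨i + 1, hi⟩))
      (fun x hx => ((hzero _).1.trans hx.1).le) isOpen_Ioo ordConnected_Ioo (hne i hi)
      (fun x hx => hEz _ x ((hzero _).1.trans hx.1).le hx.2.le) ⟨h1, h2⟩ (hc ⟨i, by omega⟩)
      hr' (hc' _)
  · intro hdec
    set zl := z ⟨k - 1, by omega⟩ with hzl
    have hzl0 : 0 < zl := (hzero _).1
    have huzl : u zl = 0 := (hzero _).2
    have hnel : ∀ x, zl < x → u x ≠ 0 := by
      intro x hx h0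
      obtain ⟨j, rfl⟩ := hall x (hzl0.trans hx) h0
      have h1 := hmono.lt_iff_lt.1 hx
      have := j.isLt
      simp only [Fin.lt_def] at h1
      omega
    have hE : ∀ x, 0 ≤ x → 0 < energy p u u' x :=
      fun x hx => hu.energy_pos_of_decaying hn hp1 hdec hnel hx
    obtain ⟨d, hd, hd'⟩ := hu.exists_critical_of_decaying hzl0 huzl hnel hdec.1
    have hEd := hE d (hzl0.trans hd).le
    refine ⟨d, hd, hd', ?_, hEF d hd' hEd, ?_, ?_⟩
    · intro r hr hr'
      exact hu.critical_unique hn hp1 (s := Ioi zl) (fun x hx => (hzl0.trans hx).le) isOpen_Ioi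
        ordConnected_Ioi hnel (fun x hx => hE x (hzl0.trans hx).le) hr hd hr' hd'
    · rw [← hu0]
      exact hu.abs_lt_of_zero_between hn hp1 hα' le_rfl hzl0 hd huzl hu.initDeriv hd' hEd
    · intro i
      exact hu.abs_lt_of_zero_between hn hp1 hα' (hcpos i).le
        (hcz i _ (by have := i.isLt; simp only; omega)) hd huzl (hc' i) hd' hEd
end

section
/- Let u be a ground state, or a bound state with finitely many zeros. Then u'(r)/u(r) → −1 as r → ∞, and for every ε ∈ (0,1), limsup_{r→∞} |u(r)| e^{(1−ε) r} < ∞. -/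
open Real Filter Set

/-- A function whose derivative is bounded below by `c > 0` on `[r₀, ∞)` exceeds every bound. -/
lemma exists_lt_of_pos_le_deriv {g g' : ℝ → ℝ} {r₀ c : ℝ} (hc : 0 < c)
    (hg : ∀ r, r₀ ≤ r → HasDerivAt g (g' r) r) (hg' : ∀ r, r₀ ≤ r → c ≤ g' r) (M : ℝ) :
    ∃ r, r₀ ≤ r ∧ M < g r := by
  have growth : ∀ r, r₀ ≤ r → c * (r - r₀) ≤ g r - g r₀ := fun r hr =>
    (convex_Ici r₀).mul_sub_le_image_sub_of_le_deriv
      (fun x hx => (hg x hx).continuousAt.continuousWithinAt)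
      (fun x hx => (hg x (interior_subset hx)).differentiableAt.differentiableWithinAt)
      (fun x hx => by
        rw [(hg x (interior_subset hx)).deriv]
        exact hg' x (interior_subset hx))
      r₀ self_mem_Ici r hr hr
  have hpos : 0 ≤ |M - g r₀| := abs_nonneg _
  have hle : r₀ ≤ r₀ + (|M - g r₀| + 1) / c := le_add_of_nonneg_right (by positivity)
  refine ⟨_, hle, ?_⟩
  have h := growth _ hle
  have heq : c * (r₀ + (|M - g r₀| + 1) / c - r₀) = |M - g r₀| + 1 := by
    field_simp
    ring
  rw [heq] at h
  linarith [le_abs_self (M - g r₀)]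

/-- A level that a function can only cross upwards is a lower barrier for it. -/
lemma le_of_deriv_pos_of_eq {w w' : ℝ → ℝ} {r₀ m : ℝ}
    (hw : ∀ r, r₀ ≤ r → HasDerivAt w (w' r) r) (h₀ : m ≤ w r₀)
    (hm : ∀ r, r₀ ≤ r → w r = m → 0 < w' r) {r : ℝ} (hr : r₀ ≤ r) : m ≤ w r :=
  image_le_of_deriv_right_lt_deriv_boundary' (f := fun _ => m) (f' := fun _ => 0) (a := r₀)
    (b := r) continuousOn_const (fun _ _ => hasDerivWithinAt_const ..) h₀
    (fun x hx => (hw x hx.1).continuousAt.continuousWithinAt)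
    (fun x hx => (hw x hx.1).hasDerivWithinAt)
    (fun x hx h => hm x hx.1 h.symm) ⟨hr, le_rfl⟩

/-- A global solution of a Riccati equation `w' = a - b w - w²` with `a → 1` and `b → 0`
that is not eventually nonnegative converges to `-1`. -/
lemma tendsto_neg_one_of_riccati {w a b : ℝ → ℝ}
    (hw : ∀ᶠ r in atTop, HasDerivAt w (a r - b r * w r - w r ^ 2) r)
    (ha : Tendsto a atTop (nhds 1)) (hb : Tendsto b atTop (nhds 0))
    (hneg : ¬ ∀ᶠ r in atTop, 0 ≤ w r) : Tendsto w atTop (nhds (-1)) := by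
  suffices key : ∀ δ : ℝ, 0 < δ → δ < 1 → ∀ᶠ r in atTop, -1 - δ ≤ w r ∧ w r ≤ -1 + δ by
    rw [Metric.tendsto_nhds]
    intro ε hε
    have hδ : 0 < min (ε / 2) (1 / 2) := by positivity
    filter_upwards [key _ hδ ((min_le_right _ _).trans_lt (by norm_num))] with r hr
    have hle := min_le_left (ε / 2) (1 / 2)
    rw [Real.dist_eq, abs_lt]
    constructor <;> linarith [hr.1, hr.2]
  intro δ hδ hδ1
  have hη : 0 < δ / 8 := by positivity
  have hae := ha.eventually (Metric.ball_mem_nhds 1 hη)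
  have hbe := hb.eventually (Metric.ball_mem_nhds 0 hη)
  obtain ⟨R, hR⟩ := eventually_atTop.1 (hw.and (hae.and hbe))
  have hwd : ∀ r, R ≤ r → HasDerivAt w (a r - b r * w r - w r ^ 2) r := fun r hr => (hR r hr).1
  have hab : ∀ r, R ≤ r →
      (-(δ / 8) < a r - 1 ∧ a r - 1 < δ / 8) ∧ (-(δ / 8) < b r ∧ b r < δ / 8) := by
    intro r hr
    obtain ⟨-, h1, h2⟩ := hR r hr
    rw [Real.dist_eq, abs_lt] at h1 h2
    rw [sub_zero] at h2
    exact ⟨h1, h2⟩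
  have below : ∀ r, R ≤ r → w r ≤ -1 - δ →
      a r - b r * w r - w r ^ 2 ≤ -(δ / 4 * w r ^ 2) := by
    intro r hr hwr
    obtain ⟨⟨h1, h2⟩, h3, h4⟩ := hab r hr
    have e1 : b r * -w r ≤ δ / 8 * -w r := mul_le_mul_of_nonneg_right h4.le (by linarith)
    have e2 : -w r ≤ w r ^ 2 := by nlinarith
    have e3 : (1 + δ) ^ 2 ≤ w r ^ 2 := by nlinarith
    have e4 : 1 ≤ (1 - δ / 2) * (1 + δ) ^ 2 := by
      nlinarith [mul_pos hδ hδ, mul_pos hδ (sub_pos.2 hδ1)]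
    have e5 : (1 - δ / 2) * (1 + δ) ^ 2 ≤ (1 - δ / 2) * w r ^ 2 :=
      mul_le_mul_of_nonneg_left e3 (by linarith)
    have e6 : δ / 8 * -w r ≤ δ / 8 * w r ^ 2 := mul_le_mul_of_nonneg_left e2 hη.le
    have e7 : δ / 8 * 1 ≤ δ / 8 * w r ^ 2 := mul_le_mul_of_nonneg_left (by nlinarith) hη.le
    nlinarith
  have above : ∀ r, R ≤ r → -1 + δ ≤ w r → w r ≤ 0 →
      δ / 2 ≤ a r - b r * w r - w r ^ 2 := by
    intro r hr h0 hwr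
    obtain ⟨⟨h1, h2⟩, h3, h4⟩ := hab r hr
    have e1 : -(δ / 8) * -w r ≤ b r * -w r := mul_le_mul_of_nonneg_right h3.le (by linarith)
    nlinarith
  filter_upwards [eventually_ge_atTop R] with r₀ hr₀
  constructor
  · by_contra! hlt
    have stay : ∀ r, r₀ ≤ r → w r ≤ -1 - δ := by
      intro r hr
      have := le_of_deriv_pos_of_eq (w := fun r => -w r) (m := 1 + δ)
        (fun r hr => (hwd r (hr₀.trans hr)).neg) (by linarith)
        (fun r hr h => by
          have := below r (hr₀.trans hr) (by linarith)
          have : 0 < δ / 4 * w r ^ 2 := mul_pos (by positivity) (by nlinarith)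
          linarith) hr
      linarith
    obtain ⟨r, hr, hpos⟩ := exists_lt_of_pos_le_deriv (g := fun r => (w r)⁻¹)
      (c := δ / 4) (by positivity)
      (fun r hr => (hwd r (hr₀.trans hr)).inv (by linarith [stay r hr]))
      (fun r hr => by
        have hw0 : 0 < w r ^ 2 := by nlinarith [stay r hr]
        rw [le_div_iff₀ hw0]
        linarith [below r (hr₀.trans hr) (stay r hr)]) 0
    have := inv_pos.1 hpos
    linarith [stay r hr]
  · by_contra! hlt
    have stay : ∀ r, r₀ ≤ r → -1 + δ ≤ w r := fun r hr =>
      le_of_deriv_pos_of_eq (fun r hr => hwd r (hr₀.trans hr)) hlt.le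
        (fun r hr h => by linarith [above r (hr₀.trans hr) h.ge (by linarith)]) hr
    by_cases hle : ∀ r, r₀ ≤ r → w r ≤ 0
    · obtain ⟨r, hr, hpos⟩ := exists_lt_of_pos_le_deriv (half_pos hδ)
        (fun r hr => hwd r (hr₀.trans hr))
        (fun r hr => above r (hr₀.trans hr) (stay r hr) (hle r hr)) 0
      linarith [hle r hr]
    · push Not at hle
      obtain ⟨r₁, hr₁, hpos⟩ := hle
      refine hneg (eventually_atTop.2 ⟨r₁, fun r hr => ?_⟩)
      exact le_of_deriv_pos_of_eq (fun r hr => hwd r (hr₀.trans (hr₁.trans hr))) hpos.le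
        (fun r hr h => by linarith [above r (hr₀.trans (hr₁.trans hr)) (by linarith) h.le]) hr

/-- If `u` is nonvanishing with logarithmic derivative eventually at most `-c`,
then `|u r| * exp (c * r)` is eventually bounded. -/
lemma exists_eventually_abs_mul_exp_le {u u' : ℝ → ℝ} {c : ℝ}
    (hd : ∀ᶠ r in atTop, HasDerivAt u (u' r) r) (hne : ∀ᶠ r in atTop, u r ≠ 0)
    (hw : ∀ᶠ r in atTop, u' r / u r ≤ -c) :
    ∃ C : ℝ, ∀ᶠ r in atTop, |u r| * Real.exp (c * r) ≤ C := by
  obtain ⟨R, hR⟩ := eventually_atTop.1 (hd.and (hne.and hw))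
  have hder : ∀ r, R ≤ r → HasDerivAt (fun r => (u r * Real.exp (c * r)) ^ 2)
      (2 * (u r * Real.exp (c * r)) ^ 2 * (u' r / u r + c)) r := by
    intro r hr
    obtain ⟨h1, h2, -⟩ := hR r hr
    have h3 := (h1.mul ((hasDerivAt_id r).const_mul c).exp).pow 2
    refine h3.congr_deriv ?_
    simp
    field_simp
  have hanti : AntitoneOn (fun r => (u r * Real.exp (c * r)) ^ 2) (Ici R) := by
    refine antitoneOn_of_deriv_nonpos (convex_Ici R)
      (fun x hx => (hder x hx).continuousAt.continuousWithinAt)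
      (fun x hx => (hder x (interior_subset hx)).differentiableAt.differentiableWithinAt)
      fun x hx => ?_
    have hx' := interior_subset hx
    rw [(hder x hx').deriv]
    exact mul_nonpos_of_nonneg_of_nonpos (by positivity) (by linarith [(hR x hx').2.2])
  refine ⟨|u R * Real.exp (c * R)|, eventually_atTop.2 ⟨R, fun r hr => ?_⟩⟩
  have h := sq_le_sq.1 (hanti self_mem_Ici hr hr)
  rwa [abs_mul (u r), Real.abs_exp] at h

/-- A nonvanishing function whose logarithmic derivative is eventually nonnegative does not
tend to `0`. -/
lemma not_tendsto_zero_of_logDeriv_nonneg {u u' : ℝ → ℝ}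
    (hd : ∀ᶠ r in atTop, HasDerivAt u (u' r) r) (hne : ∀ᶠ r in atTop, u r ≠ 0)
    (hw : ∀ᶠ r in atTop, 0 ≤ u' r / u r) : ¬ Tendsto u atTop (nhds 0) := by
  intro hu
  obtain ⟨C, hC⟩ := exists_eventually_abs_mul_exp_le (u := fun r => (u r)⁻¹)
    (u' := fun r => -u' r / u r ^ 2) (c := 0)
    (by filter_upwards [hd, hne] with r h1 h2 using h1.inv h2)
    (by filter_upwards [hne] with r h using inv_ne_zero h)
    (by
      filter_upwards [hne, hw] with r h1 h2
      have : -u' r / u r ^ 2 / (u r)⁻¹ = -(u' r / u r) := by field_simp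
      linarith)
  have hinv : Tendsto (fun r => |u r|⁻¹) atTop atTop := by
    refine tendsto_inv_nhdsGT_zero.comp (tendsto_nhdsWithin_iff.2 ⟨?_, ?_⟩)
    · simpa using hu.abs
    · filter_upwards [hne] with r h using abs_pos.2 h
  obtain ⟨r, h1, h2⟩ := (hC.and (hinv.eventually_gt_atTop C)).exists
  simp only [zero_mul, Real.exp_zero, mul_one, abs_inv] at h1
  linarith

/-- asymptotics of ground states and bound states:
`u'/u → -1` and `|u(r)| e^{(1-ε)r}` stays bounded as `r → ∞`. -/
theorem statement10 (n : ℕ) (hn : 3 ≤ n) (p : ℝ) (hp1 : 1 < p)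
    (hp2 : p < ((n : ℝ) + 2) / ((n : ℝ) - 2))
    (α : ℝ) (hα : 0 < α)
    (u u' u'' : ℝ → ℝ) (hu : IsSolution n p α u u' u'')
    (h : (Decaying u u' ∧ ∀ r : ℝ, 0 ≤ r → 0 < u r) ∨
         (Decaying u u' ∧ ChangesSign u ∧ {r : ℝ | 0 < r ∧ u r = 0}.Finite)) :
    Filter.Tendsto (fun r => u' r / u r) Filter.atTop (nhds (-1)) ∧
    ∀ ε : ℝ, 0 < ε → ε < 1 →
      ∃ C : ℝ, ∀ᶠ r in Filter.atTop, |u r| * Real.exp ((1 - ε) * r) ≤ C := by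
  obtain ⟨hu0, hne⟩ : Tendsto u atTop (nhds 0) ∧ ∀ᶠ r in atTop, u r ≠ 0 := by
    rcases h with ⟨hdec, hpos⟩ | ⟨hdec, -, hfin⟩
    · exact ⟨hdec.1, (eventually_ge_atTop 0).mono fun r hr => (hpos r hr).ne'⟩
    · obtain ⟨B, hB⟩ := hfin.bddAbove
      refine ⟨hdec.1, ?_⟩
      filter_upwards [eventually_gt_atTop 0, eventually_gt_atTop B] with r h0 h1 hz
      exact absurd (hB ⟨h0, hz⟩) (not_le.2 h1)
  have hd1 : ∀ᶠ r in atTop, HasDerivAt u (u' r) r :=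
    (eventually_gt_atTop 0).mono fun r hr => (hu.hasDeriv1 r hr.le).hasDerivAt (Ici_mem_nhds hr)
  have hd2 : ∀ᶠ r in atTop, HasDerivAt u' (u'' r) r :=
    (eventually_gt_atTop 0).mono fun r hr => (hu.hasDeriv2 r hr.le).hasDerivAt (Ici_mem_nhds hr)
  have hlim : Tendsto (fun r => u' r / u r) atTop (nhds (-1)) := by
    refine tendsto_neg_one_of_riccati (a := fun r => 1 - |u r| ^ (p - 1))
      (b := fun r => ((n : ℝ) - 1) / r) ?_ ?_ (tendsto_const_nhds.div_atTop tendsto_id)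
      fun hw => not_tendsto_zero_of_logDeriv_nonneg hd1 hne hw hu0
    · filter_upwards [hd1, hd2, hne, eventually_gt_atTop 0] with r h1 h2 h3 h4
      have ode := hu.ode r h4
      rw [f] at ode
      have hu'' : u'' r = -(((n : ℝ) - 1) / r * u' r) + u r - |u r| ^ (p - 1) * u r := by
        linarith
      refine (h2.div h1 h3).congr_deriv ?_
      rw [hu'']
      field_simp
      ring
    · have hpow := hu0.abs.rpow_const (p := p - 1) (Or.inr (by linarith))
      rw [abs_zero, Real.zero_rpow (by linarith)] at hpow
      simpa using hpow.const_sub 1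
  exact ⟨hlim, fun ε hε _ => exists_eventually_abs_mul_exp_le hd1 hne
    (hlim.eventually_le_const (by linarith))⟩
end
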